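/- The Boltzmann weights satisfy the (dynamical) Yang–Baxter equation: for all a, b, c, d, e, f ∈ ℂ^N and all u₁, u₂ ∈ ℂ such that every theta-function denominator occurring in the displayed weights is nonzero, Σ_g W(d,e;c,g|u₁)·W(c,g;b,a|u₂)·W(e,f;g,a|u₁−u₂) = Σ_g W(g,f;b,a|u₁)·W(d,e;g,f|u₂)·W(d,g;c,b|u₁−u₂), where each sum runs over g ∈ ℂ^N and has only finitely many nonzero terms (the weights vanish on non-admissible configurations). -/

import Mathlib

open scoped Classical

noncomputable section

/-- `x^w := exp(w · log x)` for a real base `x` and a complex exponent `w`. -/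
def cxp (x : ℝ) (w : ℂ) : ℂ := Complex.exp (w * Real.log x)

/-- The infinite product `(z;p)_∞ = ∏_{n≥0} (1 - z pⁿ)`. -/
def qpoch (z p : ℂ) : ℂ := ∏' n : ℕ, (1 - z * p ^ n)

/-- The double infinite product `(z;p,q)_∞ = ∏_{n₁,n₂≥0} (1 - z p^{n₁} q^{n₂})`. -/
def qpoch2 (z p q : ℂ) : ℂ := ∏' n : ℕ × ℕ, (1 - z * p ^ n.1 * q ^ n.2)

/-- The theta function `Θ_p(z) = (p;p)_∞ (z;p)_∞ (p/z;p)_∞`. -/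
def jtheta (p z : ℂ) : ℂ := qpoch p p * qpoch z p * qpoch (p / z) p

/-- The elliptic theta function `[u] = x^{u²/r - u} Θ_{x^{2r}}(x^{2u})`. -/
def ebr (x : ℝ) (r : ℕ) (u : ℂ) : ℂ :=
  cxp x (u ^ 2 / (r : ℂ) - u) * jtheta (cxp x (2 * r)) (cxp x (2 * u))

/-- `φ(z) = (x²z;x^{2r},x^{2N})_∞ (x^{2r+2N-2}z;x^{2r},x^{2N})_∞ /
((x^{2r}z;x^{2r},x^{2N})_∞ (x^{2N}z;x^{2r},x^{2N})_∞)`. -/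
def phiW (x : ℝ) (N r : ℕ) (z : ℂ) : ℂ :=
  qpoch2 (cxp x 2 * z) (cxp x (2 * r)) (cxp x (2 * N)) *
    qpoch2 (cxp x (2 * r + 2 * N - 2) * z) (cxp x (2 * r)) (cxp x (2 * N)) /
  (qpoch2 (cxp x (2 * r) * z) (cxp x (2 * r)) (cxp x (2 * N)) *
    qpoch2 (cxp x (2 * N) * z) (cxp x (2 * r)) (cxp x (2 * N)))

/-- The normalization `R(u) = z^{((r-1)/r)((N-1)/N)} φ(1/z)/φ(z)`, `z = x^{2u}`,
with `z^s := exp(2us·log x)`. -/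
def RW (x : ℝ) (N r : ℕ) (u : ℂ) : ℂ :=
  Complex.exp (2 * u * ((((r : ℂ) - 1) / (r : ℂ)) * (((N : ℂ) - 1) / (N : ℂ))) * Real.log x) *
    phiW x N r (cxp x (-2 * u)) / phiW x N r (cxp x (2 * u))

/-- The `μ`-th standard basis vector of `ℂ^N`. -/
def stdv (N : ℕ) (μ : Fin N) : Fin N → ℂ := fun i => if i = μ then 1 else 0

/-- The Boltzmann weight `W(c,d;b,a|u)` of the `U_{q,p}(A_{N-1}^{(1)})` face model:
it vanishes unless the configuration `(a,b,c,d)` is admissible, and on admissible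
configurations it is given by the three elliptic expressions of the paper. -/
def W (x : ℝ) (N r : ℕ) (cc dd bb aa : Fin N → ℂ) (u : ℂ) : ℂ :=
  (∑ μ : Fin N,
    if bb = aa + stdv N μ ∧ dd = aa + stdv N μ ∧ cc = aa + stdv N μ + stdv N μ then
      RW x N r u
    else 0)
  + (∑ μ : Fin N, ∑ ν : Fin N,
      if μ ≠ ν ∧ bb = aa + stdv N ν ∧ dd = aa + stdv N μ ∧ cc = aa + stdv N μ + stdv N ν then
        RW x N r u * ebr x r u * ebr x r (aa μ - aa ν - 1) /
          (ebr x r (u - 1) * ebr x r (aa μ - aa ν))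
      else 0)
  + (∑ μ : Fin N, ∑ ν : Fin N,
      if μ ≠ ν ∧ bb = aa + stdv N ν ∧ dd = aa + stdv N ν ∧ cc = aa + stdv N μ + stdv N ν then
        RW x N r u * ebr x r (u - (aa μ - aa ν)) * ebr x r 1 /
          (ebr x r (u - 1) * ebr x r (aa μ - aa ν))
      else 0)

/-- finite q-Pochhammer `(p;p)_m`. -/
def pfin (p : ℂ) (m : ℕ) : ℂ := ∏ k ∈ Finset.range m, (1 - p ^ (k + 1))

lemma pfin_succ (p : ℂ) (m : ℕ) : pfin p (m + 1) = pfin p m * (1 - p ^ (m + 1)) := by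
  simp [pfin, Finset.prod_range_succ]

lemma one_sub_pow_ne {p : ℂ} (hp : ‖p‖ < 1) (k : ℕ) : 1 - p ^ (k + 1) ≠ 0 := by
  intro h
  have h2 : p ^ (k + 1) = 1 := (sub_eq_zero.mp h).symm
  have h3 : ‖p‖ ^ (k + 1) = 1 := by rw [← norm_pow, h2, norm_one]
  have h4 : ‖p‖ ^ (k + 1) < 1 := pow_lt_one₀ (norm_nonneg _) hp (by omega)
  linarith

lemma pfin_ne {p : ℂ} (hp : ‖p‖ < 1) (m : ℕ) : pfin p m ≠ 0 :=
  Finset.prod_ne_zero_iff.mpr fun k _ => one_sub_pow_ne hp k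

/-- Gaussian binomial. -/
def gbin (p : ℂ) (m j : ℕ) : ℂ := if j ≤ m then pfin p m / (pfin p j * pfin p (m - j)) else 0

lemma gbin_zero {p : ℂ} (hp : ‖p‖ < 1) (m : ℕ) : gbin p m 0 = 1 := by
  have := pfin_ne hp m
  have h0 : pfin p 0 = 1 := by simp [pfin]
  simp [gbin, h0, div_self this]

lemma gbin_succ {p : ℂ} (hp : ‖p‖ < 1) (m j : ℕ) (hj : j ≤ m) :
    gbin p (m + 1) (j + 1) = gbin p m (j + 1) + p ^ (m - j) * gbin p m j := by
  rcases Nat.lt_or_ge j m with h | h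
  · obtain ⟨t, rfl⟩ := Nat.exists_eq_add_of_lt h
    have e1 : j + t + 1 + 1 - (j + 1) = t + 1 := by omega
    have e2 : j + t + 1 - (j + 1) = t := by omega
    have e3 : j + t + 1 - j = t + 1 := by omega
    have c1 : j + 1 ≤ j + t + 1 + 1 := by omega
    have c2 : j + 1 ≤ j + t + 1 := by omega
    have c3 : j ≤ j + t + 1 := by omega
    simp only [gbin, e1, e2, e3, c1, c2, c3, if_true]
    rw [pfin_succ p (j + t + 1), pfin_succ p j, pfin_succ p t]
    have := pfin_ne hp j
    have := pfin_ne hp t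
    have := one_sub_pow_ne hp j
    have := one_sub_pow_ne hp t
    field_simp
    ring
  · have : j = m := le_antisymm hj h
    subst this
    have h1 := pfin_ne hp j
    have h2 := pfin_ne hp (j + 1)
    have h0 : pfin p 0 = 1 := by simp [pfin]
    simp [gbin, h0, div_self h1, div_self h2]

lemma qbinomial {p : ℂ} (hp : ‖p‖ < 1) (y : ℂ) (m : ℕ) :
    ∏ k ∈ Finset.range m, (1 + y * p ^ k) =
      ∑ j ∈ Finset.range (m + 1), p ^ (j.choose 2) * y ^ j * gbin p m j := by
  induction m with
  | zero => simp [gbin_zero hp]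
  | succ m ih =>
    rw [Finset.prod_range_succ, ih, Finset.sum_range_succ' _ (m + 1)]
    have : ∀ j ∈ Finset.range (m + 1),
        p ^ ((j + 1).choose 2) * y ^ (j + 1) * gbin p (m + 1) (j + 1) =
        p ^ ((j + 1).choose 2) * y ^ (j + 1) * gbin p m (j + 1)
          + p ^ (j.choose 2) * y ^ j * gbin p m j * (y * p ^ m) := by
      intro j hj
      have hj' : j ≤ m := by simpa [Nat.lt_succ_iff] using hj
      rw [gbin_succ hp m j hj', show (j + 1).choose 2 = j.choose 2 + j by
        rw [Nat.choose_succ_succ' j 1]; simp [add_comm]]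
      have : p ^ m = p ^ j * p ^ (m - j) := by rw [← pow_add]; congr 1; omega
      rw [this]; ring
    rw [Finset.sum_congr rfl this, Finset.sum_add_distrib, ← Finset.sum_mul, mul_add, mul_one]
    have h2 := Finset.sum_range_succ' (fun j => p ^ (j.choose 2) * y ^ j * gbin p m j) (m + 1)
    rw [Finset.sum_range_succ] at h2
    have h3 : gbin p m (m + 1) = 0 := by simp [gbin]
    rw [h3, mul_zero, add_zero] at h2
    rw [gbin_zero hp] at *
    rw [h2]
    ring

lemma cxp_add (x : ℝ) (a b : ℂ) : cxp x (a + b) = cxp x a * cxp x b := by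
  simp [cxp, add_mul, Complex.exp_add]

lemma cxp_ne (x : ℝ) (a : ℂ) : cxp x a ≠ 0 := Complex.exp_ne_zero _

lemma cxp_zero (x : ℝ) : cxp x 0 = 1 := by simp [cxp]

lemma cxp_neg (x : ℝ) (a : ℂ) : cxp x (-a) = (cxp x a)⁻¹ := by
  simp [cxp, Complex.exp_neg]

lemma cxp_pow (x : ℝ) (a : ℂ) (n : ℕ) : cxp x a ^ n = cxp x (n * a) := by
  simp [cxp, mul_assoc, Complex.exp_nat_mul]

lemma cxp_sub (x : ℝ) (a b : ℂ) : cxp x (a - b) = cxp x a / cxp x b := by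
  rw [sub_eq_add_neg, cxp_add, cxp_neg, div_eq_mul_inv]

lemma choose_two_cast (j : ℕ) : ((j.choose 2 : ℕ) : ℂ) = (j : ℂ) * (j - 1) / 2 :=
  Nat.cast_choose_two ℂ j

lemma prod_cxp (x : ℝ) (n : ℕ) (u s : ℂ) :
    ∏ k ∈ Finset.range n, cxp x (2 * u - s * (k + 1)) =
      cxp x (2 * u * n - s * (n * (n + 1) / 2)) := by
  induction n with
  | zero => simp [cxp_zero]
  | succ n ih =>
    rw [Finset.prod_range_succ, ih, ← cxp_add]
    congr 1
    push_cast
    ring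

/-- the theta series term -/
def thT (x : ℝ) (r : ℕ) (u : ℂ) (j : ℤ) : ℂ :=
  (-1) ^ j * cxp x (r * j * (j - 1) + 2 * u * j)

lemma finite_triple (x : ℝ) (r : ℕ) (u : ℂ) (hp : ‖cxp x (2 * r)‖ < 1) (n : ℕ) :
    (∏ k ∈ Finset.range n, (1 - cxp x (2 * u) * cxp x (2 * r) ^ k)) *
      (∏ k ∈ Finset.range n, (1 - cxp x (2 * r) / cxp x (2 * u) * cxp x (2 * r) ^ k)) =
    ∑ i ∈ Finset.range (2 * n + 1), thT x r u ((i : ℤ) - n) * gbin (cxp x (2 * r)) (2 * n) i := by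
  have h := qbinomial hp (-cxp x (2 * u - 2 * r * n)) (2 * n)
  have h1 : ∏ k ∈ Finset.range (2 * n), (1 + -cxp x (2 * u - 2 * r * n) * cxp x (2 * r) ^ k) =
      (∏ k ∈ Finset.range n, (1 - cxp x (2 * u) * cxp x (2 * r) ^ k)) *
      ((-1) ^ n * cxp x (2 * u * n - 2 * r * (n * (n + 1) / 2)) *
      (∏ k ∈ Finset.range n, (1 - cxp x (2 * r) / cxp x (2 * u) * cxp x (2 * r) ^ k))) := by
    rw [two_mul n, Finset.prod_range_add, mul_comm]
    congr 1
    · refine Finset.prod_congr rfl fun k _ => ?_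
      rw [cxp_pow, cxp_pow, neg_mul, ← cxp_add, ← cxp_add, ← sub_eq_add_neg]
      congr 2
      push_cast; ring
    · rw [← Finset.prod_range_reflect, ← prod_cxp,
        show ((-1 : ℂ)) ^ n = ∏ k ∈ Finset.range n, (-1 : ℂ) by simp,
        ← Finset.prod_mul_distrib, ← Finset.prod_mul_distrib]
      refine Finset.prod_congr rfl fun k hk => ?_
      have hk' : k + 1 ≤ n := by simpa using hk
      rw [cxp_pow, cxp_pow, ← cxp_sub, neg_mul, ← cxp_add, ← cxp_add, mul_sub, mul_one,
        mul_assoc (-1 : ℂ), ← cxp_add]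
      have e1 : 2 * u - 2 * r * (k + 1) + (2 * r - 2 * u + k * (2 * r)) = (0 : ℂ) := by ring
      rw [e1, cxp_zero]
      have e2 : ((n - 1 - k : ℕ) : ℂ) = n - 1 - k := by
        rw [Nat.sub_sub, Nat.cast_sub (by omega)]; push_cast; ring
      rw [e2]
      have e3 : 2 * u - 2 * r * n + ((n : ℂ) - 1 - k) * (2 * r) = 2 * u - 2 * r * (k + 1) := by ring
      rw [e3]; ring
  rw [h1] at h
  set A := ∏ k ∈ Finset.range n, (1 - cxp x (2 * u) * cxp x (2 * r) ^ k)
  set B := ∏ k ∈ Finset.range n, (1 - cxp x (2 * r) / cxp x (2 * u) * cxp x (2 * r) ^ k)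
  have hne : ((-1 : ℂ) ^ n * cxp x (2 * u * n - 2 * r * (n * (n + 1) / 2))) ≠ 0 :=
    mul_ne_zero (pow_ne_zero _ (by norm_num)) (cxp_ne _ _)
  apply mul_left_cancel₀ hne
  calc _ = A * ((-1 : ℂ) ^ n * cxp x (2 * u * n - 2 * r * (n * (n + 1) / 2)) * B) := by ring
    _ = _ := h
    _ = _ := by
      rw [Finset.mul_sum]
      refine Finset.sum_congr rfl fun i _ => ?_
      rw [← mul_assoc]
      congr 1
      rw [thT, neg_pow, cxp_pow, cxp_pow, zpow_sub₀ (by norm_num), zpow_natCast, zpow_natCast,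
        choose_two_cast]
      have hs : ((-1 : ℂ) ^ n) ≠ 0 := pow_ne_zero _ (by norm_num)
      have : cxp x (i * (i - 1) / 2 * (2 * r)) * cxp x (i * (2 * u - 2 * r * n)) =
        cxp x (2 * u * n - 2 * r * (n * (n + 1) / 2)) *
        cxp x (r * ((i - n : ℤ) : ℂ) * (((i - n : ℤ) : ℂ) - 1) + 2 * u * ((i - n : ℤ) : ℂ)) := by
        rw [← cxp_add, ← cxp_add]; congr 1; push_cast; ring
      have q : (-1 : ℂ) ^ n * ((-1) ^ i / (-1) ^ n) = (-1) ^ i := mul_div_cancel₀ _ hs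
      linear_combination ((-1 : ℂ) ^ i) * this - (cxp x (2 * u * n - 2 * r * (n * (n + 1) / 2)) *
        cxp x (r * ((i - n : ℤ) : ℂ) * (((i - n : ℤ) : ℂ) - 1) + 2 * u * ((i - n : ℤ) : ℂ))) * q

/-- summability of Gaussian exponentials over the integers. -/
lemma summable_gauss (A B C : ℂ) (hA : A.re < 0) :
    Summable fun n : ℤ => Complex.exp (A * n ^ 2 + B * n + C) := by
  have hpi : (Real.pi : ℂ) ≠ 0 := by exact_mod_cast Real.pi_ne_zero
  have h := (summable_jacobiTheta₂_term_iff (B / (2 * Real.pi * Complex.I))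
    (A / (Real.pi * Complex.I))).mpr ?_
  · have h' := h.mul_right (Complex.exp C)
    refine h'.congr fun n => ?_
    rw [jacobiTheta₂_term, ← Complex.exp_add]
    congr 1
    have := Complex.I_ne_zero
    field_simp
    ring
  · have : A / (Real.pi * Complex.I) = -(A * Complex.I) / Real.pi := by
      have := Complex.I_ne_zero
      field_simp
      simp
    rw [this, Complex.div_ofReal_im]
    apply div_pos _ Real.pi_pos
    simpa using hA

lemma thT_summable {x : ℝ} (hx0 : 0 < x) (hx1 : x < 1) {r : ℕ} (hr : 0 < r) (u : ℂ) :
    Summable (thT x r u) := by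
  have hL : Real.log x < 0 := Real.log_neg hx0 hx1
  have h := summable_gauss (r * Real.log x) ((-r + 2 * u) * Real.log x) 0 (by
    rw [← Complex.ofReal_natCast, ← Complex.ofReal_mul, Complex.ofReal_re]
    exact mul_neg_of_pos_of_neg (by exact_mod_cast hr) hL)
  refine Summable.of_norm ((h.norm).congr fun n => ?_)
  rw [thT, norm_mul, norm_zpow, norm_neg, norm_one, one_zpow, one_mul, cxp]
  congr 2
  ring

lemma cxp_norm_lt {x : ℝ} (hx0 : 0 < x) (hx1 : x < 1) {r : ℕ} (hr : 0 < r) :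
    ‖cxp x (2 * r)‖ < 1 := by
  have hL : Real.log x < 0 := Real.log_neg hx0 hx1
  rw [cxp, Complex.norm_exp, Real.exp_lt_one_iff]
  rw [← Complex.ofReal_natCast, ← Complex.ofReal_ofNat, ← Complex.ofReal_mul,
    ← Complex.ofReal_mul, Complex.ofReal_re]
  exact mul_neg_of_pos_of_neg (by positivity) hL

lemma qpoch_tendsto {p : ℂ} (hp : ‖p‖ < 1) (z : ℂ) :
    Filter.Tendsto (fun n => ∏ k ∈ Finset.range n, (1 - z * p ^ k)) Filter.atTop
      (nhds (qpoch z p)) := by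
  have hs : Summable fun k : ℕ => ‖-(z * p ^ k)‖ := by
    simp only [norm_neg, norm_mul, norm_pow]
    exact (summable_geometric_of_lt_one (norm_nonneg _) hp).mul_left _
  have := (multipliable_one_add_of_summable hs).hasProd.tendsto_prod_nat
  simpa [qpoch, sub_eq_add_neg] using this

lemma qpoch_self_ne {p : ℂ} (hp : ‖p‖ < 1) : qpoch p p ≠ 0 := by
  have hs : Summable fun k : ℕ => ‖-(p * p ^ k)‖ := by
    simp only [norm_neg, norm_mul, norm_pow]
    exact (summable_geometric_of_lt_one (norm_nonneg _) hp).mul_left _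
  have := tprod_one_add_ne_zero_of_summable (f := fun k : ℕ => -(p * p ^ k)) (fun k => by
    have := one_sub_pow_ne hp k
    rw [pow_succ'] at this
    simpa [sub_eq_add_neg] using this) hs
  simpa [qpoch, sub_eq_add_neg] using this

lemma pfin_tendsto {p : ℂ} (hp : ‖p‖ < 1) :
    Filter.Tendsto (pfin p) Filter.atTop (nhds (qpoch p p)) := by
  refine (qpoch_tendsto hp p).congr fun n => ?_
  simp [pfin, pow_succ']

lemma triple_product {x : ℝ} (hx0 : 0 < x) (hx1 : x < 1) {r : ℕ} (hr : 0 < r) (u : ℂ) :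
    jtheta (cxp x (2 * r)) (cxp x (2 * u)) = ∑' j : ℤ, thT x r u j := by
  have hp := cxp_norm_lt hx0 hx1 hr
  set p := cxp x (2 * r) with hpdef
  have hne := qpoch_self_ne hp
  have hT := pfin_tendsto hp
  have hTi : Filter.Tendsto (fun n => (pfin p n)⁻¹) Filter.atTop (nhds (qpoch p p)⁻¹) :=
    hT.inv₀ hne
  obtain ⟨M, hM⟩ := (Metric.isBounded_range_of_tendsto _ hT).exists_norm_le
  obtain ⟨K, hK⟩ := (Metric.isBounded_range_of_tendsto _ hTi).exists_norm_le
  have hM' : ∀ n, ‖pfin p n‖ ≤ M := fun n => hM _ ⟨n, rfl⟩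
  have hK' : ∀ n, ‖(pfin p n)⁻¹‖ ≤ K := fun n => hK _ ⟨n, rfl⟩
  have hM0 : 0 ≤ M := (norm_nonneg _).trans (hM' 0)
  have hK0 : 0 ≤ K := (norm_nonneg _).trans (hK' 0)
  have hlim : Filter.Tendsto (fun n : ℕ => ∑' j : ℤ, thT x r u j *
      (if -(n : ℤ) ≤ j then gbin p (2 * n) (j + n).toNat else 0)) Filter.atTop
      (nhds (∑' j : ℤ, thT x r u j * (qpoch p p)⁻¹)) := by
    apply tendsto_tsum_of_dominated_convergence
      (bound := fun j => ‖thT x r u j‖ * (M * (K * K)))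
    · exact (thT_summable hx0 hx1 hr u).norm.mul_right _
    · intro j
      apply Filter.Tendsto.const_mul
      have e : (qpoch p p)⁻¹ = qpoch p p * ((qpoch p p)⁻¹ * (qpoch p p)⁻¹) := by field_simp
      rw [e]
      have t1 : Filter.Tendsto (fun n : ℕ => 2 * n) Filter.atTop Filter.atTop :=
        Filter.tendsto_id.const_mul_atTop' (by norm_num)
      have t2 : Filter.Tendsto (fun n : ℕ => (j + n).toNat) Filter.atTop Filter.atTop := by
        refine Filter.tendsto_atTop.mpr fun b => ?_
        filter_upwards [Filter.eventually_ge_atTop (b + j.natAbs)] with n hn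
        omega
      have t3 : Filter.Tendsto (fun n : ℕ => 2 * n - (j + n).toNat) Filter.atTop
          Filter.atTop := by
        refine Filter.tendsto_atTop.mpr fun b => ?_
        filter_upwards [Filter.eventually_ge_atTop (b + j.natAbs)] with n hn
        omega
      have := (hT.comp t1).mul ((hTi.comp t2).mul (hTi.comp t3))
      refine this.congr' ?_
      filter_upwards [Filter.eventually_ge_atTop j.natAbs] with n hn
      have c1 : -(n : ℤ) ≤ j := by omega
      have c2 : (j + n).toNat ≤ 2 * n := by omega
      simp only [gbin, c1, c2, if_true, Function.comp]
      rw [div_eq_mul_inv, mul_inv]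
    · refine Filter.Eventually.of_forall fun n j => ?_
      rw [norm_mul]
      apply mul_le_mul_of_nonneg_left _ (norm_nonneg _)
      have hb : 0 ≤ M * (K * K) := by positivity
      split_ifs
      · unfold gbin
        split_ifs
        · rw [div_eq_mul_inv, mul_inv, norm_mul, norm_mul]
          gcongr
          · exact hM' _
          · exact hK' _
          · exact hK' _
        · simpa using hb
      · simpa using hb
  have hF := (qpoch_tendsto hp (cxp x (2 * u))).mul (qpoch_tendsto hp (p / cxp x (2 * u)))
  have heq : ∀ n : ℕ, (∑' j : ℤ, thT x r u j *
      (if -(n : ℤ) ≤ j then gbin p (2 * n) (j + n).toNat else 0)) =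
      (∏ k ∈ Finset.range n, (1 - cxp x (2 * u) * p ^ k)) *
      (∏ k ∈ Finset.range n, (1 - p / cxp x (2 * u) * p ^ k)) := by
    intro n
    rw [finite_triple x r u hp n]
    rw [tsum_eq_sum (s := (Finset.range (2 * n + 1)).image (fun i : ℕ => (i : ℤ) - n))]
    · rw [Finset.sum_image (by intro a _ b _ h; simpa using h)]
      refine Finset.sum_congr rfl fun i _ => ?_
      simp [hpdef]
    · intro j hj
      by_cases c : -(n : ℤ) ≤ j
      · have : ¬ (j + n).toNat ≤ 2 * n := by
          intro hc
          apply hj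
          rw [Finset.mem_image]
          exact ⟨(j + n).toNat, by simp; omega, by omega⟩
        simp [c, gbin, this]
      · simp [c]
  have hu := tendsto_nhds_unique (hF.congr fun n => (heq n).symm) hlim
  rw [tsum_mul_right] at hu
  rw [jtheta, mul_assoc, hu]
  field_simp

/-- Gaussian lattice sums. -/
def gsum (x : ℝ) (r : ℕ) (t : ℂ) : ℂ :=
  ∑' k : ℤ, cxp x ((2 * r * k + t) ^ 2 / (2 * r))

lemma gsum_summable {x : ℝ} (hx0 : 0 < x) (hx1 : x < 1) {r : ℕ} (hr : 0 < r) (t : ℂ) :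
    Summable fun k : ℤ => cxp x ((2 * r * k + t) ^ 2 / (2 * r)) := by
  have hL : Real.log x < 0 := Real.log_neg hx0 hx1
  have h := summable_gauss ((2 * r : ℝ) * Real.log x) (2 * t * Real.log x)
    (t ^ 2 / (2 * r) * Real.log x) (by
    rw [← Complex.ofReal_mul, Complex.ofReal_re]
    exact mul_neg_of_pos_of_neg (by positivity) hL)
  refine h.congr fun n => ?_
  rw [cxp]
  congr 1
  have : (r : ℂ) ≠ 0 := by exact_mod_cast hr.ne'
  push_cast
  field_simp
  ring

lemma ebr_series {x : ℝ} (hx0 : 0 < x) (hx1 : x < 1) {r : ℕ} (hr : 0 < r) (u : ℂ) :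
    ebr x r u = ∑' n : ℤ, cxp x (u ^ 2 / (r : ℂ) - u) * thT x r u n := by
  rw [ebr, triple_product hx0 hx1 hr, tsum_mul_left]

/-- splitting of the square lattice by parity of the coordinate sum -/
def parMap : (ℤ × ℤ) ⊕ (ℤ × ℤ) → ℤ × ℤ :=
  Sum.elim (fun k => (k.1 + k.2, k.1 - k.2)) (fun k => (k.1 + k.2 + 1, k.1 - k.2))

lemma parMap_bij : Function.Bijective parMap := by
  constructor
  · rintro (⟨a, b⟩ | ⟨a, b⟩) (⟨c, d⟩ | ⟨c, d⟩) h <;> simp [parMap] at h ⊢ <;> omega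
  · rintro ⟨m, n⟩
    rcases Int.even_or_odd (m + n) with ⟨s, hs⟩ | ⟨s, hs⟩
    · exact ⟨Sum.inl (s, s - n), by simp [parMap]; omega⟩
    · exact ⟨Sum.inr (s, s - n), by simp [parMap]; omega⟩

lemma tsum_parity {f : ℤ × ℤ → ℂ} (hf : Summable f) :
    ∑' k, f k = (∑' k : ℤ × ℤ, f (k.1 + k.2, k.1 - k.2)) +
      ∑' k : ℤ × ℤ, f (k.1 + k.2 + 1, k.1 - k.2) := by
  rw [← (Equiv.ofBijective parMap parMap_bij).tsum_eq]
  have hs : Summable (f ∘ parMap) := hf.comp_injective parMap_bij.1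
  have h1 : Summable (fun k : ℤ × ℤ => f (k.1 + k.2, k.1 - k.2)) :=
    hs.comp_injective Sum.inl_injective
  have h2 : Summable (fun k : ℤ × ℤ => f (k.1 + k.2 + 1, k.1 - k.2)) :=
    hs.comp_injective Sum.inr_injective
  have := HasSum.sum (f := f ∘ parMap) h1.hasSum h2.hasSum
  exact this.tsum_eq

/-- The key factorization: `[u+v][u-v]` is a 2×2 determinant. -/
lemma ebr_mul {x : ℝ} (hx0 : 0 < x) (hx1 : x < 1) {r : ℕ} (hr : 0 < r) (u v : ℂ) :
    ebr x r (u + v) * ebr x r (u - v) = cxp x (- r / 2) *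
      (gsum x r (2 * u + r) * gsum x r (2 * v) - gsum x r (2 * u) * gsum x r (2 * v + r)) := by
  have hrc : (r : ℂ) ≠ 0 := by exact_mod_cast hr.ne'
  have s1 : Summable fun n : ℤ => cxp x ((u + v) ^ 2 / (r : ℂ) - (u + v)) * thT x r (u + v) n :=
    (thT_summable hx0 hx1 hr _).mul_left _
  have s2 : Summable fun n : ℤ => cxp x ((u - v) ^ 2 / (r : ℂ) - (u - v)) * thT x r (u - v) n :=
    (thT_summable hx0 hx1 hr _).mul_left _
  have gs : ∀ s t : ℂ, gsum x r s * gsum x r t = ∑' k : ℤ × ℤ,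
      cxp x ((2 * r * k.1 + s) ^ 2 / (2 * r)) * cxp x ((2 * r * k.2 + t) ^ 2 / (2 * r)) := by
    intro s t
    exact tsum_mul_tsum_of_summable_norm (gsum_summable hx0 hx1 hr s).norm
      (gsum_summable hx0 hx1 hr t).norm
  -- shift the first odd sum
  have sh : gsum x r (2 * u - r) = gsum x r (2 * u + r) := by
    unfold gsum
    rw [← (Equiv.addRight (1 : ℤ)).tsum_eq]
    refine tsum_congr fun k => ?_
    congr 1
    simp only [Equiv.coe_addRight]
    push_cast
    ring
  rw [ebr_series hx0 hx1 hr, ebr_series hx0 hx1 hr,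
    tsum_mul_tsum_of_summable_norm s1.norm s2.norm,
    tsum_parity (summable_mul_of_summable_norm s1.norm s2.norm), ← sh, mul_sub, gs, gs,
    ← tsum_mul_left, ← tsum_mul_left]
  refine Eq.trans ?_ (sub_eq_add_neg _ _).symm
  rw [← tsum_neg]
  congr 1
  · refine tsum_congr fun k => ?_
    have sgn : ((-1 : ℂ) ^ (k.1 + k.2)) * (-1) ^ (k.1 - k.2) = 1 := by
      rw [← zpow_add₀ (by norm_num)]
      exact Even.neg_one_zpow ⟨k.1, by ring⟩
    simp only [thT]
    have : cxp x ((u + v) ^ 2 / (r : ℂ) - (u + v)) *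
        cxp x (r * ((k.1 + k.2 : ℤ) : ℂ) * (((k.1 + k.2 : ℤ) : ℂ) - 1)
          + 2 * (u + v) * ((k.1 + k.2 : ℤ) : ℂ)) *
        (cxp x ((u - v) ^ 2 / (r : ℂ) - (u - v)) *
        cxp x (r * ((k.1 - k.2 : ℤ) : ℂ) * (((k.1 - k.2 : ℤ) : ℂ) - 1)
          + 2 * (u - v) * ((k.1 - k.2 : ℤ) : ℂ))) =
        cxp x (-r / 2) * (cxp x ((2 * r * k.1 + (2 * u - r)) ^ 2 / (2 * r)) *
          cxp x ((2 * r * k.2 + 2 * v) ^ 2 / (2 * r))) := by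
      simp only [← cxp_add]
      congr 1
      push_cast
      field_simp
      ring
    rw [← this]
    linear_combination (cxp x ((u + v) ^ 2 / (r : ℂ) - (u + v)) *
        cxp x (r * ((k.1 + k.2 : ℤ) : ℂ) * (((k.1 + k.2 : ℤ) : ℂ) - 1)
          + 2 * (u + v) * ((k.1 + k.2 : ℤ) : ℂ)) *
        (cxp x ((u - v) ^ 2 / (r : ℂ) - (u - v)) *
        cxp x (r * ((k.1 - k.2 : ℤ) : ℂ) * (((k.1 - k.2 : ℤ) : ℂ) - 1)
          + 2 * (u - v) * ((k.1 - k.2 : ℤ) : ℂ)))) * sgn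
  · refine tsum_congr fun k => ?_
    have sgn : ((-1 : ℂ) ^ (k.1 + k.2 + 1)) * (-1) ^ (k.1 - k.2) = -1 := by
      rw [← zpow_add₀ (by norm_num)]
      exact Odd.neg_one_zpow ⟨k.1, by ring⟩
    simp only [thT]
    have : cxp x ((u + v) ^ 2 / (r : ℂ) - (u + v)) *
        cxp x (r * ((k.1 + k.2 + 1 : ℤ) : ℂ) * (((k.1 + k.2 + 1 : ℤ) : ℂ) - 1)
          + 2 * (u + v) * ((k.1 + k.2 + 1 : ℤ) : ℂ)) *
        (cxp x ((u - v) ^ 2 / (r : ℂ) - (u - v)) *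
        cxp x (r * ((k.1 - k.2 : ℤ) : ℂ) * (((k.1 - k.2 : ℤ) : ℂ) - 1)
          + 2 * (u - v) * ((k.1 - k.2 : ℤ) : ℂ))) =
        cxp x (-r / 2) * (cxp x ((2 * r * k.1 + 2 * u) ^ 2 / (2 * r)) *
          cxp x ((2 * r * k.2 + (2 * v + r)) ^ 2 / (2 * r))) := by
      simp only [← cxp_add]
      congr 1
      push_cast
      field_simp
      ring
    rw [← this]
    linear_combination (cxp x ((u + v) ^ 2 / (r : ℂ) - (u + v)) *
        cxp x (r * ((k.1 + k.2 + 1 : ℤ) : ℂ) * (((k.1 + k.2 + 1 : ℤ) : ℂ) - 1)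
          + 2 * (u + v) * ((k.1 + k.2 + 1 : ℤ) : ℂ)) *
        (cxp x ((u - v) ^ 2 / (r : ℂ) - (u - v)) *
        cxp x (r * ((k.1 - k.2 : ℤ) : ℂ) * (((k.1 - k.2 : ℤ) : ℂ) - 1)
          + 2 * (u - v) * ((k.1 - k.2 : ℤ) : ℂ)))) * sgn

/-- Weierstrass three-term identity. -/
lemma ebr_three {x : ℝ} (hx0 : 0 < x) (hx1 : x < 1) {r : ℕ} (hr : 0 < r) (a b c d : ℂ) :
    ebr x r (a + b) * ebr x r (a - b) * (ebr x r (c + d) * ebr x r (c - d)) +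
    ebr x r (a + c) * ebr x r (a - c) * (ebr x r (d + b) * ebr x r (d - b)) +
    ebr x r (a + d) * ebr x r (a - d) * (ebr x r (b + c) * ebr x r (b - c)) = 0 := by
  simp only [ebr_mul hx0 hx1 hr]
  ring

lemma ebr_neg {x : ℝ} (hx0 : 0 < x) (hx1 : x < 1) {r : ℕ} (hr : 0 < r) (s : ℂ)
    (hs : ebr x r s ≠ 0) (t : ℂ) : ebr x r (-t) = - ebr x r t := by
  have h1 := ebr_mul hx0 hx1 hr ((s + t) / 2) ((s - t) / 2)
  have h2 := ebr_mul hx0 hx1 hr ((s - t) / 2) ((s + t) / 2)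
  rw [show (s + t) / 2 + (s - t) / 2 = s by ring, show (s + t) / 2 - (s - t) / 2 = t by ring] at h1
  rw [show (s - t) / 2 + (s + t) / 2 = s by ring, show (s - t) / 2 - (s + t) / 2 = -t by ring] at h2
  apply mul_left_cancel₀ hs
  rw [h2]
  rw [mul_neg, h1]
  ring

/-- exchange weight -/
def alW (br : ℂ → ℂ) (u A : ℂ) : ℂ := br u * br (A - 1) / (br (u - 1) * br A)

/-- transmission weight -/
def beW (br : ℂ → ℂ) (u A : ℂ) : ℂ := br (u - A) * br 1 / (br (u - 1) * br A)

/-- abstract bracket: odd function with the three-term identity -/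
def IsBr (br : ℂ → ℂ) : Prop :=
  (∀ t, br (-t) = - br t) ∧ ∀ a b c d : ℂ,
    br (a + b) * br (a - b) * (br (c + d) * br (c - d)) +
    br (a + c) * br (a - c) * (br (d + b) * br (d - b)) +
    br (a + d) * br (a - d) * (br (b + c) * br (b - c)) = 0

lemma IsBr.three {br : ℂ → ℂ} (h : IsBr br) (S T P Q X1 X2 Y1 Y2 Z1 Z2 V1 V2 : ℂ)
    (h1 : 2 * X1 = S + T + P + Q) (h2 : 2 * X2 = S + T - P - Q)
    (h3 : 2 * Y1 = P - Q + S - T) (h4 : 2 * Y2 = P - Q - S + T)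
    (h5 : 2 * Z1 = S + T + P - Q) (h6 : 2 * Z2 = S + T - P + Q)
    (h7 : 2 * V1 = S - T + P + Q) (h8 : 2 * V2 = S - T - P - Q) :
    br S * br T * (br P * br Q) + br X1 * br X2 * (br Y1 * br Y2)
      + br Z1 * br Z2 * (br V1 * br V2) = 0 := by
  have := h.2 ((S + T) / 2) ((S - T) / 2) ((P + Q) / 2) ((P - Q) / 2)
  convert this using 6 <;> first
    | linear_combination (1 / 2 : ℂ) * h1
    | linear_combination (1 / 2 : ℂ) * h2
    | linear_combination (1 / 2 : ℂ) * h3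
    | linear_combination (1 / 2 : ℂ) * h4
    | linear_combination (1 / 2 : ℂ) * h5
    | linear_combination (1 / 2 : ℂ) * h6
    | linear_combination (1 / 2 : ℂ) * h7
    | linear_combination (1 / 2 : ℂ) * h8
    | ring_nf

lemma zero_of_mul_zero {E X : ℂ} (e : E = 0) (Y : ℂ) (hX : X = Y * E) : X = 0 := by
  rw [hX, e, mul_zero]

section
variable {br : ℂ → ℂ}

lemma IsBr.E1 (h : IsBr br) (A B : ℂ) : br (A + 1) * br (A - 1) * br B ^ 2
    - br (A + B) * br (A - B) * br 1 ^ 2 - br A ^ 2 * br (B + 1) * br (B - 1) = 0 := by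
  have := h.three (A + 1) (A - 1) B B (A + B) (A - B) 1 (-1) A A (B + 1) (-(B - 1))
    (by ring) (by ring) (by ring) (by ring) (by ring) (by ring) (by ring) (by ring)
  rw [h.1, h.1] at this
  linear_combination this

lemma IsBr.E2 (h : IsBr br) (u v A B : ℂ) : br (v - A) * br (u - A) * br (u + v - B) * br B
    - br (v - B) * br (u - B) * br (u + v - A) * br A
    + br u * br v * br (u + v - (A + B)) * br (A - B) = 0 := by
  have := h.three (v - A) (u - A) (u + v - B) B (u + v - A) (-A) (v - B) (u - B)
    (u + v - (A + B)) (-(A - B)) v (-u)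
    (by ring) (by ring) (by ring) (by ring) (by ring) (by ring) (by ring) (by ring)
  rw [h.1, h.1, h.1] at this
  linear_combination this

lemma IsBr.E3 (h : IsBr br) (u v A : ℂ) : br (u + v - A) * br A * br (u - 1) * br (v - 1)
    - br (u - A) * br (v - A) * br (u + v - 1) * br 1
    - br u * br v * br (A - 1) * br (u + v - (A + 1)) = 0 := by
  have := h.three (u + v - A) A (u - 1) (v - 1) (u + v - 1) 1 (u - A) (-(v - A))
    u v (u + v - (A + 1)) (-(A - 1))
    (by ring) (by ring) (by ring) (by ring) (by ring) (by ring) (by ring) (by ring)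
  rw [h.1, h.1] at this
  linear_combination this

lemma IsBr.E4 (h : IsBr br) (u v A : ℂ) : br (u + v) * br (u - (A + 1)) * br (v - 1) * br A
    - br (u - A) * br v * br (u + v - 1) * br (A + 1)
    + br u * br (u + v - (A + 1)) * br (v + A) * br 1 = 0 := by
  have := h.three (u + v) (u - (A + 1)) (v - 1) A (u + v - 1) (u - A) v (-(A + 1))
    (u + v - (A + 1)) u (v + A) 1
    (by ring) (by ring) (by ring) (by ring) (by ring) (by ring) (by ring) (by ring)
  rw [h.1] at this
  linear_combination this

lemma IsBr.E5 (h : IsBr br) (u v A B : ℂ) : br (v - A) * br (u + v - B) * br u * br (A + B)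
    - br v * br (u + v - (A + B)) * br (u + A) * br B
    - br (u - B) * br (u + v) * br (v - (A + B)) * br A = 0 := by
  have := h.three (v - A) (u + v - B) u (A + B) (u + v) (v - (A + B)) (-A) (u - B)
    (u + v - (A + B)) v B (-(u + A))
    (by ring) (by ring) (by ring) (by ring) (by ring) (by ring) (by ring) (by ring)
  rw [h.1, h.1] at this
  linear_combination this

lemma IsBr.alneg (h : IsBr br) (u A : ℂ) :
    alW br u (-A) = br u * br (A + 1) / (br (u - 1) * br A) := by
  rw [alW, show -A - 1 = -(A + 1) by ring, h.1, h.1, mul_neg, mul_neg, neg_div_neg_eq]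

lemma IsBr.beneg (h : IsBr br) (u A : ℂ) :
    beW br u (-A) = - (br (u + A) * br 1 / (br (u - 1) * br A)) := by
  rw [beW, sub_neg_eq_add, h.1, mul_neg, div_neg]

lemma IsBr.I1 (h : IsBr br) (u v A B C An Bn : ℂ) (hC : C = A + B) (hAn : An = -A)
    (hBn : Bn = -B) (hu : br (u - 1) ≠ 0) (hv : br (v - 1) ≠ 0) (hw : br (u + v - 1) ≠ 0)
    (hA : br A ≠ 0) (hB : br B ≠ 0) (hCn : br C ≠ 0) :
    beW br v A * beW br (u + v) B * beW br u A + alW br v A * beW br (u + v) C * alW br u An =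
    beW br u B * beW br (u + v) A * beW br v B + alW br u B * beW br (u + v) C * alW br v Bn := by
  subst hC hAn hBn
  have e1 := h.E1 A B
  have e2 := h.E2 u v A B
  rw [h.alneg, h.alneg]
  simp only [alW, beW]
  generalize br (u - 1) = du at *
  generalize br (v - 1) = dv at *
  generalize br (u + v - 1) = dw at *
  generalize br (A - 1) = x1 at *
  generalize br (A + 1) = x2 at *
  generalize br (B - 1) = x3 at *
  generalize br (B + 1) = x4 at *
  generalize br (A + B) = x5 at *
  generalize br (A - B) = x6 at *
  generalize br (u + v - (A + B)) = x7 at *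
  generalize br (u + v - A) = x8 at *
  generalize br (u + v - B) = x9 at *
  generalize br (u - A) = y1 at *
  generalize br (v - A) = y2 at *
  generalize br (u - B) = y3 at *
  generalize br (v - B) = y4 at *
  generalize br A = y5 at *
  generalize br B = y6 at *
  generalize br u = y7 at *
  generalize br v = y8 at *
  generalize br 1 = y9 at *
  field_simp
  first
  | linear_combination (y7 * y8 * x7) * e1 + y9 ^ 2 * x5 * e2
  | linear_combination (y7 * y8 * x7 * y9) * e1 + y9 ^ 3 * x5 * e2

lemma IsBr.I2 (h : IsBr br) (u v A B C An : ℂ) (hC : C = A + B) (hAn : An = -A)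
    (hu : br (u - 1) ≠ 0) (hv : br (v - 1) ≠ 0) (hw : br (u + v - 1) ≠ 0)
    (hA : br A ≠ 0) (hB : br B ≠ 0) (hCn : br C ≠ 0) :
    beW br v A * beW br (u + v) B * alW br u A + alW br v A * beW br (u + v) C * beW br u An =
    beW br u B * alW br (u + v) A * beW br v C := by
  subst hC hAn
  have e := h.E5 u v A B
  rw [h.beneg]
  simp only [alW, beW]
  rw [← sub_eq_zero]
  refine zero_of_mul_zero e (br 1 ^ 2 * br (A - 1) / (br A ^ 2 * br B * br (A + B) *
    (br (u - 1) * br (v - 1) * br (u + v - 1)))) ?_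
  generalize br (u - 1) = du at *
  generalize br (v - 1) = dv at *
  generalize br (u + v - 1) = dw at *
  generalize br (A - 1) = x1 at *
  generalize br (A + B) = x5 at *
  generalize br (u + v - (A + B)) = x7 at *
  generalize br (v - (A + B)) = x8 at *
  generalize br (u + v - B) = x9 at *
  generalize br (u + A) = y1 at *
  generalize br (v - A) = y2 at *
  generalize br (u - B) = y3 at *
  generalize br A = y5 at *
  generalize br B = y6 at *
  generalize br u = y7 at *
  generalize br v = y8 at *
  generalize br (u + v) = y4 at *
  generalize br 1 = y9 at *
  field_simp
  ring

lemma IsBr.K1 (h : IsBr br) (u v A B An Bn : ℂ) (hC : B = 1 - A) (hAn : An = -A)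
    (hBn : Bn = -B) (hu : br (u - 1) ≠ 0) (hv : br (v - 1) ≠ 0) (hw : br (u + v - 1) ≠ 0)
    (hA : br A ≠ 0) (hB : br B ≠ 0) :
    beW br v A * beW br (u + v) B * beW br u A + alW br v A * alW br u An =
    beW br u B * beW br (u + v) A * beW br v B + alW br u B * alW br v Bn := by
  subst hAn hBn
  have hC' : A + B = 1 := by rw [hC]; ring
  have e1 := h.E1 A B
  have e2 := h.E2 u v A B
  rw [hC'] at e1 e2
  rw [h.alneg, h.alneg]
  simp only [alW, beW]
  clear hC hC'
  generalize br (u - 1) = du at *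
  generalize br (v - 1) = dv at *
  generalize br (u + v - 1) = dw at *
  generalize br (A - 1) = x1 at *
  generalize br (A + 1) = x2 at *
  generalize br (B - 1) = x3 at *
  generalize br (B + 1) = x4 at *
  generalize br (A - B) = x6 at *
  generalize br (u + v - A) = x8 at *
  generalize br (u + v - B) = x9 at *
  generalize br (u - A) = y1 at *
  generalize br (v - A) = y2 at *
  generalize br (u - B) = y3 at *
  generalize br (v - B) = y4 at *
  generalize br A = y5 at *
  generalize br B = y6 at *
  generalize br u = y7 at *
  generalize br v = y8 at *
  generalize br 1 = y9 at *
  field_simp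
  linear_combination (y7 * y8 * dw) * e1 + y9 ^ 3 * e2

lemma IsBr.K2 (h : IsBr br) (u v A B An : ℂ) (hC : B = 1 - A) (hAn : An = -A)
    (hu : br (u - 1) ≠ 0) (hv : br (v - 1) ≠ 0) (hw : br (u + v - 1) ≠ 0)
    (hA : br A ≠ 0) (hB : br B ≠ 0) :
    beW br v A * beW br (u + v) B * alW br u A + alW br v A * beW br u An =
    beW br u B * alW br (u + v) A := by
  subst hAn
  have hC' : A + B = 1 := by rw [hC]; ring
  have e := h.E5 u v A B
  rw [hC'] at e
  rw [h.beneg]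
  simp only [alW, beW]
  clear hC hC'
  rw [← sub_eq_zero]
  refine zero_of_mul_zero e (br 1 * br (A - 1) / (br A ^ 2 * br B *
    (br (u - 1) * br (v - 1) * br (u + v - 1)))) ?_
  generalize br (u - 1) = du at *
  generalize br (v - 1) = dv at *
  generalize br (u + v - 1) = dw at *
  generalize br (A - 1) = x1 at *
  generalize br (u + v - B) = x9 at *
  generalize br (u + A) = y1 at *
  generalize br (v - A) = y2 at *
  generalize br (u - B) = y3 at *
  generalize br A = y5 at *
  generalize br B = y6 at *
  generalize br u = y7 at *
  generalize br v = y8 at *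
  generalize br (u + v) = y4 at *
  generalize br 1 = y9 at *
  field_simp
  ring

lemma IsBr.J1 (h : IsBr br) (u v A B An : ℂ) (hC : B = A + 1) (hAn : An = -A)
    (hu : br (u - 1) ≠ 0) (hv : br (v - 1) ≠ 0) (hw : br (u + v - 1) ≠ 0)
    (hA : br A ≠ 0) (hB : br B ≠ 0) :
    beW br (u + v) A =
      beW br u A * beW br v A + alW br u A * beW br (u + v) B * alW br v An := by
  subst hC hAn
  have e := h.E3 u v A
  rw [h.alneg]
  simp only [alW, beW]
  rw [← sub_eq_zero]
  refine zero_of_mul_zero e (br 1 / (br A ^ 2 * (br (u - 1) * br (v - 1) * br (u + v - 1)))) ?_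
  generalize br (u - 1) = du at *
  generalize br (v - 1) = dv at *
  generalize br (u + v - 1) = dw at *
  generalize br (A - 1) = x1 at *
  generalize br (A + 1) = x2 at *
  generalize br (u + v - A) = x9 at *
  generalize br (u + v - (A + 1)) = x8 at *
  generalize br (u - A) = y1 at *
  generalize br (v - A) = y2 at *
  generalize br A = y5 at *
  generalize br u = y7 at *
  generalize br v = y8 at *
  generalize br 1 = y9 at *
  field_simp
  ring

lemma IsBr.J2 (h : IsBr br) (u v A B An : ℂ) (hC : B = A + 1) (hAn : An = -A)
    (hu : br (u - 1) ≠ 0) (hv : br (v - 1) ≠ 0) (hw : br (u + v - 1) ≠ 0)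
    (hA : br A ≠ 0) (hB : br B ≠ 0) :
    alW br (u + v) A * beW br u B =
      beW br u A * alW br v A + alW br u A * beW br (u + v) B * beW br v An := by
  subst hC hAn
  have e := h.E4 u v A
  rw [h.beneg]
  simp only [alW, beW]
  rw [← sub_eq_zero]
  refine zero_of_mul_zero e (br 1 * br (A - 1) / (br A ^ 2 * br (A + 1) *
    (br (u - 1) * br (v - 1) * br (u + v - 1)))) ?_
  generalize br (u - 1) = du at *
  generalize br (v - 1) = dv at *
  generalize br (u + v - 1) = dw at *
  generalize br (A - 1) = x1 at *
  generalize br (A + 1) = x2 at *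
  generalize br (u - (A + 1)) = x9 at *
  generalize br (u + v - (A + 1)) = x8 at *
  generalize br (u - A) = y1 at *
  generalize br (v + A) = y2 at *
  generalize br A = y5 at *
  generalize br u = y7 at *
  generalize br v = y8 at *
  generalize br (u + v) = y4 at *
  generalize br 1 = y9 at *
  field_simp
  ring

end

lemma alW_comm (br : ℂ → ℂ) (u w A B : ℂ) :
    alW br u A * alW br w B = alW br w A * alW br u B := by
  simp only [alW]; ring

/-- The face weight in path form: path `i, j` is turned into path `p, q`. -/
def Sw {N : ℕ} (br : ℂ → ℂ) (a : Fin N → ℂ) (i j p q : Fin N) (u : ℂ) : ℂ :=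
  if i = j then (if p = i ∧ q = i then 1 else 0)
  else if p = i ∧ q = j then beW br u (a j - a i)
  else if p = j ∧ q = i then alW br u (a j - a i) else 0

lemma Sw_sum2 {N : ℕ} (br : ℂ → ℂ) (a : Fin N → ℂ) (i j : Fin N) (u : ℂ)
    (F : Fin N → Fin N → ℂ) :
    ∑ p, ∑ q, Sw br a i j p q u * F p q =
      if i = j then F i i else beW br u (a j - a i) * F i j + alW br u (a j - a i) * F j i := by
  by_cases h : i = j
  · simp [Sw, h, ite_and]
  · have : ∀ p q, Sw br a i j p q u * F p q =
        (if p = i then (if q = j then beW br u (a j - a i) * F p q else 0) else 0) +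
        (if p = j then (if q = i then alW br u (a j - a i) * F p q else 0) else 0) := by
      intro p q
      simp only [Sw, h, if_false]
      by_cases h1 : p = i
      · have : ¬ p = j := fun hh => h (h1 ▸ hh)
        by_cases h2 : q = j <;> simp [h1, h2, h]
      · simp only [h1, false_and, if_false, zero_add]
        by_cases h2 : p = j <;> by_cases h3 : q = i <;> simp [h2, h3]
    simp only [this, Finset.sum_add_distrib, h, if_false]
    simp

/-- sum over the first output index -/
lemma Sw_sum_left {N : ℕ} (br : ℂ → ℂ) (a : Fin N → ℂ) (i j n : Fin N) (u : ℂ)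
    (F : Fin N → ℂ) :
    ∑ s, F s * Sw br a i j s n u =
      if i = j then (if n = i then F i else 0) else
        (if n = j then F i * beW br u (a j - a i) else 0)
        + (if n = i then F j * alW br u (a j - a i) else 0) := by
  by_cases h : i = j
  · simp [Sw, h, ite_and]
  · by_cases h1 : n = i
    · have h2 : ¬ n = j := fun hh => h (h1 ▸ hh)
      simp [Sw, h, h1]
    · by_cases h2 : n = j
      · have h3 : ¬ j = i := fun hh => h hh.symm
        simp [Sw, h, h2, h3]
      · simp [Sw, h, h1, h2]

/-- sum over the second output index -/
lemma Sw_sum_right {N : ℕ} (br : ℂ → ℂ) (a : Fin N → ℂ) (i j l : Fin N) (u : ℂ)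
    (F : Fin N → ℂ) :
    ∑ s, Sw br a i j l s u * F s =
      if i = j then (if l = i then F i else 0) else
        (if l = i then beW br u (a j - a i) * F j else 0)
        + (if l = j then alW br u (a j - a i) * F i else 0) := by
  by_cases h : i = j
  · by_cases h1 : l = j <;> simp [Sw, h, h1]
  · by_cases h1 : l = i
    · have h2 : ¬ l = j := fun hh => h (h1 ▸ hh)
      simp [Sw, h, h1]
    · by_cases h2 : l = j
      · have h3 : ¬ j = i := fun hh => h hh.symm
        simp [Sw, h, h2, h3]
      · simp [Sw, h, h1, h2]

lemma YB_expand {N : ℕ} (br : ℂ → ℂ) (a : Fin N → ℂ) (i j k l m n : Fin N) (u v : ℂ)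
    (H : (if i = j then
        (fun p q => if q = k then (if n = q then Sw br a p q l m u else 0) else
          (if n = k then Sw br a p q l m u *
            beW br (u + v) ((a + stdv N p) k - (a + stdv N p) q) else 0)
          + (if n = q then Sw br a p k l m u *
            alW br (u + v) ((a + stdv N p) k - (a + stdv N p) q) else 0)) i i
      else beW br v (a j - a i) *
        (fun p q => if q = k then (if n = q then Sw br a p q l m u else 0) else
          (if n = k then Sw br a p q l m u *
            beW br (u + v) ((a + stdv N p) k - (a + stdv N p) q) else 0)
          + (if n = q then Sw br a p k l m u *
            alW br (u + v) ((a + stdv N p) k - (a + stdv N p) q) else 0)) i j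
        + alW br v (a j - a i) *
        (fun p q => if q = k then (if n = q then Sw br a p q l m u else 0) else
          (if n = k then Sw br a p q l m u *
            beW br (u + v) ((a + stdv N p) k - (a + stdv N p) q) else 0)
          + (if n = q then Sw br a p k l m u *
            alW br (u + v) ((a + stdv N p) k - (a + stdv N p) q) else 0)) j i) =
      (if j = k then
        (fun p q => if i = p then (if l = i then Sw br (a + stdv N l) i q m n v else 0) else
        (if l = i then beW br (u + v) (a p - a i) * Sw br (a + stdv N l) p q m n v else 0)
        + (if l = p then alW br (u + v) (a p - a i) *
            Sw br (a + stdv N l) i q m n v else 0)) j j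
      else beW br u ((a + stdv N i) k - (a + stdv N i) j) *
        (fun p q => if i = p then (if l = i then Sw br (a + stdv N l) i q m n v else 0) else
        (if l = i then beW br (u + v) (a p - a i) * Sw br (a + stdv N l) p q m n v else 0)
        + (if l = p then alW br (u + v) (a p - a i) *
            Sw br (a + stdv N l) i q m n v else 0)) j k
      + alW br u ((a + stdv N i) k - (a + stdv N i) j) *
        (fun p q => if i = p then (if l = i then Sw br (a + stdv N l) i q m n v else 0) else
        (if l = i then beW br (u + v) (a p - a i) * Sw br (a + stdv N l) p q m n v else 0)
        + (if l = p then alW br (u + v) (a p - a i) *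
            Sw br (a + stdv N l) i q m n v else 0)) k j)) :
    ∑ p, ∑ q, Sw br a i j p q v * ∑ s, Sw br a p s l m u * Sw br (a + stdv N p) q k s n (u + v) =
    ∑ p, ∑ q, Sw br (a + stdv N i) j k p q u * ∑ s, Sw br a i p l s (u + v) *
      Sw br (a + stdv N l) s q m n v := by
  rw [Sw_sum2, Sw_sum2]
  simp only [Sw_sum_left, Sw_sum_right]
  exact H

lemma YB_paths {N : ℕ} {br : ℂ → ℂ} (h : IsBr br) (a : Fin N → ℂ) (i j k l m n : Fin N)
    (u v : ℂ) (hu : br (u - 1) ≠ 0) (hv : br (v - 1) ≠ 0) (hw : br (u + v - 1) ≠ 0)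
    (ha : ∀ μ ν : Fin N, μ ≠ ν → br (a μ - a ν) ≠ 0)
    (hg : ∀ κ μ ν : Fin N, μ ≠ ν → br ((a + stdv N κ) μ - (a + stdv N κ) ν) ≠ 0) :
    ∑ p, ∑ q, Sw br a i j p q v * ∑ s, Sw br a p s l m u * Sw br (a + stdv N p) q k s n (u + v) =
    ∑ p, ∑ q, Sw br (a + stdv N i) j k p q u * ∑ s, Sw br a i p l s (u + v) *
      Sw br (a + stdv N l) s q m n v := by
  have hgp : ∀ μ ν : Fin N, μ ≠ ν → br (a μ + 1 - a ν) ≠ 0 := by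
    intro μ ν hne
    simpa [stdv, hne, hne.symm] using hg μ μ ν hne
  have hgm : ∀ μ ν : Fin N, μ ≠ ν → br (a μ - (a ν + 1)) ≠ 0 := by
    intro μ ν hne
    simpa [stdv, hne, hne.symm] using hg ν μ ν hne
  have hw' : br (v + u - 1) ≠ 0 := by rwa [add_comm v u]
  apply YB_expand
  by_cases hij : i = j
  · subst hij
    by_cases hik : i = k
    · subst hik
      by_cases hl : l = i <;> by_cases hm : m = i <;> by_cases hn : n = i <;>
        simp [Sw, hl, hm, hn]
    · -- word (i,i,k)
      have hki : ¬ k = i := fun hh => hik hh.symm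
      have t (x : Fin N) : x = i ∨ x = k ∨ (x ≠ i ∧ x ≠ k) := by tauto
      rcases t l with rfl | rfl | ⟨l1, l2⟩ <;> rcases t m with rfl | rfl | ⟨m1, m2⟩ <;>
        rcases t n with rfl | rfl | ⟨n1, n2⟩ <;>
        simp [Sw, stdv, *]
      · have e := h.J1 u v (a n - (a m + 1)) (a n - a m) (a m + 1 - a n) (by ring) (by ring) hu hv hw (hgm n m (by assumption)) (ha n m (by assumption))
        linear_combination e
      · have e := h.J2 u v (a m - (a n + 1)) (a m - a n) (a n + 1 - a m) (by ring) (by ring) hu hv hw (hgm m n (by assumption)) (ha m n (by assumption))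
        linear_combination e
      · have e := alW_comm br u (u + v) (a l - a n) (a l - (a n + 1))
        linear_combination e
  · have hji : ¬ j = i := fun hh => hij hh.symm
    by_cases hik : i = k
    · subst hik
      -- word (i,j,i)
      have t (x : Fin N) : x = i ∨ x = j ∨ (x ≠ i ∧ x ≠ j) := by tauto
      rcases t l with rfl | rfl | ⟨l1, l2⟩ <;> rcases t m with rfl | rfl | ⟨m1, m2⟩ <;>
        rcases t n with rfl | rfl | ⟨n1, n2⟩ <;>
        simp [Sw, stdv, *]
      · have e := h.K2 v u (a m + 1 - a n) (a n - a m) (a n - (a m + 1)) (by ring) (by ring) hv hu hw' (hgp m n (by assumption)) (ha n m (by assumption))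
        rw [add_comm v u] at e
        linear_combination -e
      · have e := h.K1 u v (a m - a n) (a n + 1 - a m) (a n - a m) (a m - (a n + 1)) (by ring) (by ring) (by ring) hu hv hw (ha m n (by assumption)) (hgp n m (by assumption))
        linear_combination e
      · have e := h.K2 u v (a l - a n) (a n + 1 - a l) (a n - a l) (by ring) (by ring) hu hv hw (ha l n (by assumption)) (hgp n l (by assumption))
        linear_combination e
    · have hki : ¬ k = i := fun hh => hik hh.symm
      by_cases hjk : j = k
      · subst hjk
        -- word (i,j,j)
        have t (x : Fin N) : x = i ∨ x = j ∨ (x ≠ i ∧ x ≠ j) := by tauto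
        rcases t l with rfl | rfl | ⟨l1, l2⟩ <;> rcases t m with rfl | rfl | ⟨m1, m2⟩ <;>
          rcases t n with rfl | rfl | ⟨n1, n2⟩ <;>
          simp [Sw, stdv, *]
        · have e := h.J1 v u (a n - a l) (a n + 1 - a l) (a l - a n) (by ring) (by ring) hv hu hw' (ha n l (by assumption)) (hgp n l (by assumption))
          rw [add_comm v u] at e
          linear_combination -e
        · have e := h.J2 v u (a n - a m) (a n + 1 - a m) (a m - a n) (by ring) (by ring) hv hu hw' (ha n m (by assumption)) (hgp n m (by assumption))
          rw [add_comm v u] at e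
          linear_combination -e
        · have e := alW_comm br v (u + v) (a m - a n) (a m + 1 - a n)
          linear_combination e
      · have hkj : ¬ k = j := fun hh => hjk hh.symm
        have t (x : Fin N) : x = i ∨ x = j ∨ x = k ∨ (x ≠ i ∧ x ≠ j ∧ x ≠ k) := by tauto
        rcases t l with rfl | rfl | rfl | ⟨l1, l2, l3⟩ <;>
          rcases t m with rfl | rfl | rfl | ⟨m1, m2, m3⟩ <;>
          rcases t n with rfl | rfl | rfl | ⟨n1, n2, n3⟩ <;>
          simp [Sw, stdv, *]
        · have e := h.I1 u v (a m - a l) (a n - a m) (a n - a l) (a l - a m) (a m - a n) (by ring) (by ring) (by ring) hu hv hw (ha m l (by assumption)) (ha n m (by assumption)) (ha n l (by assumption))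
          linear_combination e
        · have e := h.I2 v u (a m - a n) (a n - a l) (a m - a l) (a n - a m) (by ring) (by ring) hv hu hw' (ha m n (by assumption)) (ha n l (by assumption)) (ha m l (by assumption))
          rw [add_comm v u] at e
          linear_combination -e
        · have e := h.I2 u v (a l - a m) (a n - a l) (a n - a m) (a m - a l) (by ring) (by ring) hu hv hw (ha l m (by assumption)) (ha n l (by assumption)) (ha n m (by assumption))
          linear_combination e
        · have e := congrArg (fun t => beW br u (a m - a l) * t) (alW_comm br v (u + v) (a l - a n) (a m - a n))
          linear_combination e
        · have e := congrArg (fun t => beW br v (a n - a m) * t) (alW_comm br u (u + v) (a l - a m) (a l - a n))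
          linear_combination e
        · ring

lemma stdv_inj {N : ℕ} {i j : Fin N} (h : stdv N i = stdv N j) : i = j := by
  by_contra hne
  have := congrFun h i
  simp [stdv, hne] at this

lemma stdv_pair {N : ℕ} {i j p q : Fin N} (h : stdv N i + stdv N j = stdv N p + stdv N q) :
    (p = i ∧ q = j) ∨ (p = j ∧ q = i) := by
  by_cases h1 : p = i
  · subst h1
    exact Or.inl ⟨rfl, (stdv_inj (add_left_cancel h)).symm⟩
  · by_cases h2 : p = j
    · subst h2
      rw [add_comm] at h
      exact Or.inr ⟨rfl, (stdv_inj (add_left_cancel h)).symm⟩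
    · exfalso
      have := congrFun h p
      simp only [Pi.add_apply, stdv, h1, h2, if_false, if_true, add_zero] at this
      split_ifs at this <;> norm_num at this

lemma path_pair {N : ℕ} {a : Fin N → ℂ} {i j p q : Fin N} :
    a + stdv N i + stdv N j = a + stdv N p + stdv N q ↔
    (p = i ∧ q = j) ∨ (p = j ∧ q = i) := by
  constructor
  · intro h
    rw [add_assoc, add_assoc] at h
    exact stdv_pair (add_left_cancel h)
  · rintro (⟨rfl, rfl⟩ | ⟨rfl, rfl⟩)
    · rfl
    · rw [add_right_comm]

lemma step_inj {N : ℕ} {a : Fin N → ℂ} {i j : Fin N} :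
    a + stdv N i = a + stdv N j ↔ i = j :=
  ⟨fun h => stdv_inj (add_left_cancel h), fun h => by rw [h]⟩

lemma W_path (x : ℝ) (N r : ℕ) (a : Fin N → ℂ) (i j p q : Fin N) (u : ℂ)
    (h : a + stdv N i + stdv N j = a + stdv N p + stdv N q) :
    W x N r (a + stdv N i + stdv N j) (a + stdv N p) (a + stdv N i) a u =
      RW x N r u * Sw (ebr x r) a i j p q u := by
  unfold W
  simp only [step_inj, path_pair]
  rw [path_pair] at h
  by_cases hij : i = j
  · subst hij
    have hp : p = i ∧ q = i := by tauto
    obtain ⟨rfl, rfl⟩ := hp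
    have c1 : ∀ μ : Fin N, (q = μ ∧ q = μ ∧ (μ = q ∧ μ = q ∨ μ = q ∧ μ = q)) ↔ μ = q := by
      grind
    have c2 : ∀ μ ν : Fin N, (μ ≠ ν ∧ q = ν ∧ q = μ ∧ (μ = q ∧ ν = q ∨ μ = q ∧ ν = q)) ↔ False := by
      grind
    have c3 : ∀ μ ν : Fin N, (μ ≠ ν ∧ q = ν ∧ q = ν ∧ (μ = q ∧ ν = q ∨ μ = q ∧ ν = q)) ↔ False := by
      grind
    simp only [c1, c2, c3]
    simp [Sw]
  · rcases h with ⟨rfl, rfl⟩ | ⟨rfl, rfl⟩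
    · have c1 : ∀ μ : Fin N, (p = μ ∧ p = μ ∧ (μ = p ∧ μ = q ∨ μ = q ∧ μ = p)) ↔ False := by
        grind
      have c2 : ∀ μ ν : Fin N,
          (μ ≠ ν ∧ p = ν ∧ p = μ ∧ (μ = p ∧ ν = q ∨ μ = q ∧ ν = p)) ↔ False := by
        grind
      have c3 : ∀ μ ν : Fin N,
          (μ ≠ ν ∧ p = ν ∧ p = ν ∧ (μ = p ∧ ν = q ∨ μ = q ∧ ν = p)) ↔ (μ = q ∧ ν = p) := by
        grind
      simp only [c1, c2, c3]
      simp [Sw, hij, ite_and, beW]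
      ring
    · have hji : ¬ p = q := fun hh => hij hh.symm
      have c1 : ∀ μ : Fin N, (q = μ ∧ p = μ ∧ (μ = q ∧ μ = p ∨ μ = p ∧ μ = q)) ↔ False := by
        grind
      have c2 : ∀ μ ν : Fin N,
          (μ ≠ ν ∧ q = ν ∧ p = μ ∧ (μ = q ∧ ν = p ∨ μ = p ∧ ν = q)) ↔ (μ = p ∧ ν = q) := by
        grind
      have c3 : ∀ μ ν : Fin N,
          (μ ≠ ν ∧ q = ν ∧ p = ν ∧ (μ = q ∧ ν = p ∨ μ = p ∧ ν = q)) ↔ False := by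
        grind
      simp only [c1, c2, c3]
      simp [Sw, hij, hji, ite_and, alW]
      ring

lemma W_adm {x : ℝ} {N r : ℕ} {cc dd bb aa : Fin N → ℂ} {u : ℂ}
    (h : W x N r cc dd bb aa u ≠ 0) :
    ∃ i j p q : Fin N, bb = aa + stdv N i ∧ cc = aa + stdv N i + stdv N j ∧
      dd = aa + stdv N p ∧ cc = aa + stdv N p + stdv N q := by
  by_contra hcon
  apply h
  unfold W
  have c1 : ∀ μ : Fin N, ¬ (bb = aa + stdv N μ ∧ dd = aa + stdv N μ ∧
      cc = aa + stdv N μ + stdv N μ) := by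
    rintro μ ⟨h1, h2, h3⟩
    exact hcon ⟨μ, μ, μ, μ, h1, h3, h2, h3⟩
  have c2 : ∀ μ ν : Fin N, ¬ (μ ≠ ν ∧ bb = aa + stdv N ν ∧ dd = aa + stdv N μ ∧
      cc = aa + stdv N μ + stdv N ν) := by
    rintro μ ν ⟨_, h1, h2, h3⟩
    exact hcon ⟨ν, μ, μ, ν, h1, by rw [h3, add_right_comm], h2, h3⟩
  have c3 : ∀ μ ν : Fin N, ¬ (μ ≠ ν ∧ bb = aa + stdv N ν ∧ dd = aa + stdv N ν ∧
      cc = aa + stdv N μ + stdv N ν) := by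
    rintro μ ν ⟨_, h1, h2, h3⟩
    exact hcon ⟨ν, μ, ν, μ, h1, by rw [h3, add_right_comm], h2, by rw [h3, add_right_comm]⟩
  simp only [c1, c2, c3, if_false, Finset.sum_const_zero, add_zero]

lemma Sw_ne {N : ℕ} {br : ℂ → ℂ} {a a' : Fin N → ℂ} {i j p q : Fin N} {u : ℂ}
    (h : Sw br a i j p q u ≠ 0) :
    a' + stdv N i + stdv N j = a' + stdv N p + stdv N q := by
  rw [path_pair]
  by_contra hc
  apply h
  unfold Sw
  split_ifs <;> grind

lemma W_sum_out (x : ℝ) (N r : ℕ) (a : Fin N → ℂ) (i j p : Fin N) (u X : ℂ) (F : Fin N → ℂ)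
    (hF : ∀ q, a + stdv N i + stdv N j = a + stdv N p + stdv N q → X = F q) :
    W x N r (a + stdv N i + stdv N j) (a + stdv N p) (a + stdv N i) a u * X =
      RW x N r u * ∑ q, Sw (ebr x r) a i j p q u * F q := by
  by_cases hq : ∃ q, a + stdv N i + stdv N j = a + stdv N p + stdv N q
  · obtain ⟨q, hq⟩ := hq
    rw [W_path x N r a i j p q u hq, hF q hq, Finset.sum_eq_single q, mul_assoc]
    · intro q' _ hne
      by_cases hz : Sw (ebr x r) a i j p q' u = 0
      · rw [hz, zero_mul]
      · have := hq.symm.trans (Sw_ne (a' := a) hz)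
        exact absurd (step_inj.mp this).symm hne
    · simp
  · have hW : W x N r (a + stdv N i + stdv N j) (a + stdv N p) (a + stdv N i) a u = 0 := by
      by_contra hne
      obtain ⟨i', j', p', q', h1, h2, h3, h4⟩ := W_adm hne
      exact hq ⟨q', by rw [h4, h3]⟩
    rw [hW, zero_mul, Finset.sum_eq_zero, mul_zero]
    intro q _
    by_cases hz : Sw (ebr x r) a i j p q u = 0
    · rw [hz, zero_mul]
    · exact absurd ⟨q, Sw_ne (a' := a) hz⟩ hq

lemma W_sum_in (x : ℝ) (N r : ℕ) (a : Fin N → ℂ) (p l m : Fin N) (u X : ℂ) (F : Fin N → ℂ)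
    (hF : ∀ s, a + stdv N p + stdv N s = a + stdv N l + stdv N m → X = F s) :
    W x N r (a + stdv N l + stdv N m) (a + stdv N l) (a + stdv N p) a u * X =
      RW x N r u * ∑ s, Sw (ebr x r) a p s l m u * F s := by
  by_cases hq : ∃ s, a + stdv N p + stdv N s = a + stdv N l + stdv N m
  · obtain ⟨q, hq⟩ := hq
    rw [← hq, W_path x N r a p q l m u hq, hF q hq, Finset.sum_eq_single q, mul_assoc]
    · intro q' _ hne
      by_cases hz : Sw (ebr x r) a p q' l m u = 0
      · rw [hz, zero_mul]
      · have := hq.trans (Sw_ne (a' := a) hz).symm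
        exact absurd (step_inj.mp this).symm hne
    · simp
  · have hW : W x N r (a + stdv N l + stdv N m) (a + stdv N l) (a + stdv N p) a u = 0 := by
      by_contra hne
      obtain ⟨i', j', p', q', h1, h2, h3, h4⟩ := W_adm hne
      exact hq ⟨j', by rw [h2, h1]⟩
    rw [hW, zero_mul, Finset.sum_eq_zero, mul_zero]
    intro q _
    by_cases hz : Sw (ebr x r) a p q l m u = 0
    · rw [hz, zero_mul]
    · exact absurd ⟨q, Sw_ne (a' := a) hz⟩ hq

lemma finsum_step {N : ℕ} (a : Fin N → ℂ) (F : (Fin N → ℂ) → ℂ)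
    (hF : ∀ g, F g ≠ 0 → ∃ p, g = a + stdv N p) :
    ∑ᶠ g, F g = ∑ p, F (a + stdv N p) := by
  rw [finsum_eq_sum_of_support_subset (s := Finset.univ.image fun p => a + stdv N p)]
  · rw [Finset.sum_image]
    intro p _ q _ hpq
    exact step_inj.mp hpq
  · intro g hg
    obtain ⟨p, rfl⟩ := hF g hg
    simp

lemma YB_adm (x : ℝ) (N r : ℕ) (a : Fin N → ℂ) (i j k l m n : Fin N) (u v : ℂ)
    (hd : a + stdv N i + stdv N j + stdv N k = a + stdv N l + stdv N m + stdv N n)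
    (hx0 : 0 < x) (hx1 : x < 1) (hr : 0 < r)
    (hu : ebr x r (u - 1) ≠ 0) (hv : ebr x r (v - 1) ≠ 0) (hw : ebr x r (u + v - 1) ≠ 0)
    (ha : ∀ μ ν : Fin N, μ ≠ ν → ebr x r (a μ - a ν) ≠ 0)
    (hg : ∀ κ μ ν : Fin N, μ ≠ ν →
      ebr x r ((a + stdv N κ) μ - (a + stdv N κ) ν) ≠ 0) :
    (∑ᶠ g : Fin N → ℂ,
        W x N r (a + stdv N i + stdv N j + stdv N k) (a + stdv N l + stdv N m)
          (a + stdv N i + stdv N j) g (u + v) *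
        W x N r (a + stdv N i + stdv N j) g (a + stdv N i) a v *
        W x N r (a + stdv N l + stdv N m) (a + stdv N l) g a u)
    = ∑ᶠ g : Fin N → ℂ,
        W x N r g (a + stdv N l) (a + stdv N i) a (u + v) *
        W x N r (a + stdv N i + stdv N j + stdv N k) (a + stdv N l + stdv N m) g
          (a + stdv N l) v *
        W x N r (a + stdv N i + stdv N j + stdv N k) g (a + stdv N i + stdv N j)
          (a + stdv N i) u := by
  have hbr : IsBr (ebr x r) :=
    ⟨ebr_neg hx0 hx1 hr _ hu, ebr_three hx0 hx1 hr⟩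
  rw [finsum_step a, finsum_step (a + stdv N i)]
  rotate_left
  · intro g hne
    obtain ⟨_, _, p, _, _, _, h3, _⟩ := W_adm (right_ne_zero_of_mul hne)
    exact ⟨p, h3⟩
  · intro g hne
    obtain ⟨p, _, _, _, h3, _⟩ := W_adm (right_ne_zero_of_mul hne)
    exact ⟨p, h3⟩
  have key := YB_paths hbr a i j k l m n u v hu hv hw ha hg
  have hL : ∀ p, W x N r (a + stdv N i + stdv N j + stdv N k) (a + stdv N l + stdv N m)
          (a + stdv N i + stdv N j) (a + stdv N p) (u + v) *
        W x N r (a + stdv N i + stdv N j) (a + stdv N p) (a + stdv N i) a v *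
        W x N r (a + stdv N l + stdv N m) (a + stdv N l) (a + stdv N p) a u =
      RW x N r u * RW x N r v * RW x N r (u + v) *
      ∑ q, Sw (ebr x r) a i j p q v * ∑ s, Sw (ebr x r) a p s l m u *
        Sw (ebr x r) (a + stdv N p) q k s n (u + v) := by
    intro p
    have := W_sum_out x N r a i j p v
      (W x N r (a + stdv N l + stdv N m) (a + stdv N l) (a + stdv N p) a u *
        W x N r (a + stdv N i + stdv N j + stdv N k) (a + stdv N l + stdv N m)
          (a + stdv N i + stdv N j) (a + stdv N p) (u + v))
      (fun q => RW x N r u * ∑ s, Sw (ebr x r) a p s l m u *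
        (RW x N r (u + v) * Sw (ebr x r) (a + stdv N p) q k s n (u + v)))
      (fun q hq => W_sum_in x N r a p l m u _ _ (fun s hs => by
        rw [hq, ← hs] at hd
        rw [hq, ← hs]
        exact W_path x N r (a + stdv N p) q k s n (u + v) hd))
    rw [mul_comm (W x N r (a + stdv N i + stdv N j + stdv N k) _ _ _ _), mul_assoc,
      mul_comm (W x N r (a + stdv N i + stdv N j + stdv N k) _ _ _ _), this]
    simp only [Finset.mul_sum]
    refine Finset.sum_congr rfl fun q _ => Finset.sum_congr rfl fun s _ => ?_
    ring
  have hR : ∀ p, W x N r (a + stdv N i + stdv N p) (a + stdv N l) (a + stdv N i) a (u + v) *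
        W x N r (a + stdv N i + stdv N j + stdv N k) (a + stdv N l + stdv N m)
          (a + stdv N i + stdv N p) (a + stdv N l) v *
        W x N r (a + stdv N i + stdv N j + stdv N k) (a + stdv N i + stdv N p)
          (a + stdv N i + stdv N j) (a + stdv N i) u =
      RW x N r u * RW x N r v * RW x N r (u + v) *
      ∑ q, Sw (ebr x r) (a + stdv N i) j k p q u * ∑ s, Sw (ebr x r) a i p l s (u + v) *
        Sw (ebr x r) (a + stdv N l) s q m n v := by
    intro p
    have := W_sum_out x N r (a + stdv N i) j k p u
      (W x N r (a + stdv N i + stdv N p) (a + stdv N l) (a + stdv N i) a (u + v) *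
        W x N r (a + stdv N i + stdv N j + stdv N k) (a + stdv N l + stdv N m)
          (a + stdv N i + stdv N p) (a + stdv N l) v)
      (fun q => RW x N r (u + v) * ∑ s, Sw (ebr x r) a i p l s (u + v) *
        (RW x N r v * Sw (ebr x r) (a + stdv N l) s q m n v))
      (fun q hq => W_sum_out x N r a i p l (u + v) _ _ (fun s hs => by
        rw [hq, hs] at hd
        rw [hq, hs]
        exact W_path x N r (a + stdv N l) s q m n v hd))
    rw [mul_comm, this]
    simp only [Finset.mul_sum]
    refine Finset.sum_congr rfl fun q _ => Finset.sum_congr rfl fun s _ => ?_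
    ring
  simp only [hL, hR]
  rw [← Finset.mul_sum, ← Finset.mul_sum, key]

/-- The dynamical Yang–Baxter equation for the Boltzmann weights. -/
theorem yang_baxter (x : ℝ) (hx0 : 0 < x) (hx1 : x < 1)
    (N r : ℕ) (hN : 2 ≤ N) (hr : N + 2 ≤ r)
    (a b c d e f : Fin N → ℂ) (u₁ u₂ : ℂ)
    (h1 : ebr x r (u₁ - 1) ≠ 0) (h2 : ebr x r (u₂ - 1) ≠ 0)
    (h3 : ebr x r (u₁ - u₂ - 1) ≠ 0)
    (ha : ∀ μ ν : Fin N, μ ≠ ν → ebr x r (a μ - a ν) ≠ 0)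
    (hb : ∀ μ ν : Fin N, μ ≠ ν → ebr x r (b μ - b ν) ≠ 0)
    (hf : ∀ μ ν : Fin N, μ ≠ ν → ebr x r (f μ - f ν) ≠ 0)
    (hg : ∀ κ μ ν : Fin N, μ ≠ ν →
      ebr x r ((a + stdv N κ) μ - (a + stdv N κ) ν) ≠ 0) :
    (∑ᶠ g : Fin N → ℂ,
        W x N r d e c g u₁ * W x N r c g b a u₂ * W x N r e f g a (u₁ - u₂))
    = ∑ᶠ g : Fin N → ℂ,
        W x N r g f b a u₁ * W x N r d e g f u₂ * W x N r d g c b (u₁ - u₂) := by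
  have hr0 : 0 < r := by omega
  by_cases hP : ∃ i j k l m n : Fin N, b = a + stdv N i ∧ c = b + stdv N j ∧ d = c + stdv N k ∧
      f = a + stdv N l ∧ e = f + stdv N m ∧ d = e + stdv N n
  · obtain ⟨i, j, k, l, m, n, rfl, rfl, hd, rfl, rfl, hd'⟩ := hP
    have h1' : u₁ = (u₁ - u₂) + u₂ := by ring
    have := YB_adm x N r a i j k l m n (u₁ - u₂) u₂ (hd.symm.trans hd') hx0 hx1 hr0 h3 h2
      (by rw [← h1']; exact h1) ha hg
    rw [← h1', ← hd] at this
    exact this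
  · have hL : ∀ g, W x N r d e c g u₁ * W x N r c g b a u₂ * W x N r e f g a (u₁ - u₂) = 0 := by
      intro g
      by_contra hne
      obtain ⟨i1, j1, p1, q1, e1, e2, e3, e4⟩ :=
        W_adm (left_ne_zero_of_mul (left_ne_zero_of_mul hne))
      obtain ⟨i2, j2, p2, q2, g1, g2, g3, g4⟩ :=
        W_adm (right_ne_zero_of_mul (left_ne_zero_of_mul hne))
      obtain ⟨i3, j3, p3, q3, k1, k2, k3, k4⟩ := W_adm (right_ne_zero_of_mul hne)
      exact hP ⟨i2, j2, j1, p3, q3, q1, g1, by rw [g2, g1], by rw [e2, e1], k3,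
        by rw [k4, k3], by rw [e4, e3]⟩
    have hR : ∀ g, W x N r g f b a u₁ * W x N r d e g f u₂ * W x N r d g c b (u₁ - u₂) = 0 := by
      intro g
      by_contra hne
      obtain ⟨i1, j1, p1, q1, e1, e2, e3, e4⟩ :=
        W_adm (left_ne_zero_of_mul (left_ne_zero_of_mul hne))
      obtain ⟨i2, j2, p2, q2, g1, g2, g3, g4⟩ :=
        W_adm (right_ne_zero_of_mul (left_ne_zero_of_mul hne))
      obtain ⟨i3, j3, p3, q3, k1, k2, k3, k4⟩ := W_adm (right_ne_zero_of_mul hne)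
      exact hP ⟨i1, i3, j3, p1, p2, q2, e1, k1, by rw [k2, k1], e3, g3, by rw [g4, g3]⟩
    simp only [hL, hR]
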